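/- Let T be a continuous bundle random dynamical system on E over (Ω,F,P,ϑ) with (T_ω^k)^{-1}x ≠ ∅ for all k and x ∈ X_E, and let f ∈ L^1_E(Ω,C(X)). Then for each x ∈ X_E, k,n ∈ ℕ with k ≥ n, and each nonrandom small ε > 0: (i) the function ω ↦ P_{pre,n,ω}(T,f,ε,(T_ω^k)^{-1}x) is measurable in ω; (ii) for any δ > 0 there exists a family of maximal (ω,n,ε)-separated sets G_ω ⊂ (T_ω^k)^{-1}x ⊂ E_ω with Σ_{y∈G_ω} exp S_n f(ω,y) ≥ (1−δ) P_{pre,n,ω}(T,f,ε,(T_ω^k)^{-1}x), depending measurably on ω in the sense that G = {(ω,x) : x ∈ G_ω} ∈ F×B, equivalently ω ↦ G_ω is measurable with respect to the Borel σ-algebra induced by the Hausdorff topology on the space K(X) of compact subsets of X. In particular, the supremum in the definition of P_{pre,n,ω}(T,f,ε,(T_ω^k)^{-1}x) can be taken only over families of (ω,n,ε)-separated sets that are measurable in ω. -/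

import Mathlib

open MeasureTheory Filter Set

namespace PreImageRDS

variable {Ω : Type} [MeasurableSpace Ω] {X : Type} [MetricSpace X] [CompactSpace X]
  [MeasurableSpace X] [BorelSpace X]

/-- The fiber `E_ω = {x : (ω, x) ∈ E}`. -/
def fiber (E : Set (Ω × X)) (ω : Ω) : Set X := {x | (ω, x) ∈ E}

/-- `X_E = {x : (ω, x) ∈ E for some ω}`. -/
def XE (E : Set (Ω × X)) : Set X := {x | ∃ ω, (ω, x) ∈ E}

/-- The iterates `T_ω^n = T_{ϑ^{n-1}ω} ∘ ⋯ ∘ T_{ϑω} ∘ T_ω`. -/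
def Tn (ϑ : Ω → Ω) (T : Ω → X → X) : ℕ → Ω → X → X
  | 0 => fun _ x => x
  | n + 1 => fun ω x => Tn ϑ T n (ϑ ω) (T ω x)

/-- The skew product `Θ(ω,x) = (ϑω, T_ω x)`. -/
def skew (ϑ : Ω → Ω) (T : Ω → X → X) : Ω × X → Ω × X := fun p => (ϑ p.1, T p.1 p.2)

/-- The Bowen metric `d_n^ω(y,z) = max_{0 ≤ i < n} d(T_ω^i y, T_ω^i z)`. -/
noncomputable def dn (ϑ : Ω → Ω) (T : Ω → X → X) (n : ℕ) (ω : Ω) (y z : X) : ℝ :=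
  ((Finset.range n).sup fun i => nndist (Tn ϑ T i ω y) (Tn ϑ T i ω z) : NNReal)

/-- `F` is `(ω,n,ε)`-separated. -/
def IsSep (ϑ : Ω → Ω) (T : Ω → X → X) (n : ℕ) (ε : ℝ) (ω : Ω) (F : Set X) : Prop :=
  ∀ y ∈ F, ∀ z ∈ F, y ≠ z → ε < dn ϑ T n ω y z

/-- The pre-image fiber `(T_ω^k)^{-1} x ⊆ E_ω`. -/
def preFiber (ϑ : Ω → Ω) (T : Ω → X → X) (E : Set (Ω × X)) (k : ℕ) (x : X) (ω : Ω) :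
    Set X :=
  {y ∈ fiber E ω | Tn ϑ T k ω y = x}

/-- The Birkhoff sum `S_n f(ω,y) = ∑_{i<n} f(ϑ^i ω, T_ω^i y)`. -/
noncomputable def Snf (ϑ : Ω → Ω) (T : Ω → X → X) (f : Ω → X → ℝ) (n : ℕ) (ω : Ω)
    (y : X) : ℝ :=
  ∑ i ∈ Finset.range n, f (ϑ^[i] ω) (Tn ϑ T i ω y)

/-- `P_{pre,n,ω}(T,f,ε,(T_ω^k)^{-1}x)`. -/
noncomputable def PpreN (ϑ : Ω → Ω) (T : Ω → X → X) (E : Set (Ω × X)) (f : Ω → X → ℝ)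
    (n k : ℕ) (ε : ℝ) (x : X) (ω : Ω) : ℝ :=
  sSup {r : ℝ | ∃ F : Finset X, ↑F ⊆ preFiber ϑ T E k x ω ∧ IsSep ϑ T n ε ω ↑F ∧
    r = ∑ y ∈ F, Real.exp (Snf ϑ T f n ω y)}

/-- `P_pre(T,f,ε)`. -/
noncomputable def PpreEps (P : Measure Ω) (ϑ : Ω → Ω) (T : Ω → X → X) (E : Set (Ω × X))
    (f : Ω → X → ℝ) (ε : ℝ) : ℝ :=
  limsup (fun n : ℕ => (1 / (n : ℝ)) *
    sSup {r : ℝ | ∃ k ≥ n, ∃ x ∈ XE E,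
      r = ∫ ω, Real.log (PpreN ϑ T E f n k ε x ω) ∂P}) atTop

/-- The pre-image topological pressure `P_pre(T,f) = lim_{ε→0} P_pre(T,f,ε)
    (`= sup_{ε>0} P_pre(T,f,ε)` by monotonicity in `ε`). -/
noncomputable def Ppre (P : Measure Ω) (ϑ : Ω → Ω) (T : Ω → X → X) (E : Set (Ω × X))
    (f : Ω → X → ℝ) : ℝ :=
  sSup {r : ℝ | ∃ ε > (0 : ℝ), r = PpreEps P ϑ T E f ε}

/-- The σ-algebra `F_E` (sets depending only on ω). -/
def mF (Ω X : Type) [MeasurableSpace Ω] [MeasurableSpace X] : MeasurableSpace (Ω × X) :=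
  MeasurableSpace.comap Prod.fst inferInstance

/-- The σ-algebra `(F×B)^-_E = ⋂_{n ≥ 0} Θ^{-n}(F×B)_E`. -/
def mMinus (ϑ : Ω → Ω) (T : Ω → X → X) : MeasurableSpace (Ω × X) :=
  ⨅ n : ℕ, MeasurableSpace.comap ((skew ϑ T)^[n]) inferInstance

/-- The fiberwise σ-algebra `B^-_ω = ⋂_{n ≥ 0}(T_ω^n)^{-1} B_{ϑ^n ω}`. -/
def mMinusFiber (ϑ : Ω → Ω) (T : Ω → X → X) (ω : Ω) : MeasurableSpace X :=
  ⨅ n : ℕ, MeasurableSpace.comap (Tn ϑ T n ω) inferInstance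

/-- Conditional entropy `H_μ(Q | m)` of a finite family of sets given a σ-algebra `m`,
    via conditional expectations of indicators. -/
noncomputable def condEntropyFam {α : Type} [MeasurableSpace α] (μ : Measure α)
    (m : MeasurableSpace α) {ι : Type} [Fintype ι] (Q : ι → Set α) : ℝ :=
  - ∫ a, ∑ i, ((μ[(Q i).indicator (fun _ => (1 : ℝ)) | m]) a) *
      Real.log ((μ[(Q i).indicator (fun _ => (1 : ℝ)) | m]) a) ∂μ

/-- `Q` is a finite measurable partition of `E`. -/
def IsFinPart {α : Type} [MeasurableSpace α] {ι : Type} [Fintype ι] (Q : ι → Set α)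
    (E : Set α) : Prop :=
  (∀ i, MeasurableSet (Q i)) ∧ (∀ i j, i ≠ j → Disjoint (Q i) (Q j)) ∧ (⋃ i, Q i) = E

/-- `h^{(r)}_{pre,μ}(T,Q) = lim_n (1/n) H_μ(⋁_{i<n} Θ^{-i}Q | F_E ∨ (F×B)^-_E)`. -/
noncomputable def hPrePart (ϑ : Ω → Ω) (T : Ω → X → X) (μ : Measure (Ω × X))
    {N : ℕ} (Q : Fin N → Set (Ω × X)) : ℝ :=
  limsup (fun n : ℕ => (1 / (n : ℝ)) * condEntropyFam μ (mF Ω X ⊔ mMinus ϑ T)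
    (fun j : Fin n → Fin N => ⋂ i : Fin n, (skew ϑ T)^[(i : ℕ)] ⁻¹' Q (j i))) atTop

/-- The pre-image measure-theoretic entropy `h^{(r)}_{pre,μ}(T)`. -/
noncomputable def hPre (ϑ : Ω → Ω) (T : Ω → X → X) (E : Set (Ω × X))
    (μ : Measure (Ω × X)) : ℝ :=
  sSup {h : ℝ | ∃ (N : ℕ) (Q : Fin N → Set (Ω × X)), IsFinPart Q E ∧
    h = hPrePart ϑ T μ Q}

/-- `μ ∈ M^1_P(E,T)`: a Θ-invariant probability measure on `E` with marginal `P`. -/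
def IsPInv (P : Measure Ω) (ϑ : Ω → Ω) (T : Ω → X → X) (E : Set (Ω × X))
    (μ : Measure (Ω × X)) : Prop :=
  IsProbabilityMeasure μ ∧ μ E = 1 ∧ μ.map Prod.fst = P ∧ μ.map (skew ϑ T) = μ


/-! ### Analytic sets are universally measurable -/

section Capacity

open Topology ENNReal

theorem isCompact_setOf_forall_le (m : ℕ → ℕ) : IsCompact {z : ℕ → ℕ | ∀ i, z i ≤ m i} := by
  have hbox : {z : ℕ → ℕ | ∀ i, z i ≤ m i} = Set.univ.pi fun i => Set.Iic (m i) := by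
    ext z
    simp [Pi.le_def]
  rw [hbox]
  exact isCompact_univ_pi fun i => (Set.finite_Iic (m i)).isCompact

/-- If an open set contains the compact box `∏ [0, m i]` of Baire space, then it contains one of
the finite-stage boxes `{z | ∀ i < N, z i ≤ m i}`. -/
theorem exists_forall_lt_le_subset_of_isOpen {V : Set (ℕ → ℕ)} (hV : IsOpen V) (m : ℕ → ℕ)
    (hm : {z : ℕ → ℕ | ∀ i, z i ≤ m i} ⊆ V) :
    ∃ N, {z : ℕ → ℕ | ∀ i < N, z i ≤ m i} ⊆ V := by
  by_contra! h
  simp only [Set.not_subset] at h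
  choose z hz hzV using h
  obtain ⟨w, hw, φ, hφ, hlim⟩ := (isCompact_setOf_forall_le m).tendsto_subseq (x := fun n i => min (z n i) (m i))
    fun n i => min_le_right _ _
  have hlim' : Tendsto (z ∘ φ) atTop (𝓝 w) := by
    rw [tendsto_pi_nhds] at hlim ⊢
    intro i
    refine (hlim i).congr' ?_
    filter_upwards [eventually_gt_atTop i] with j hj
    exact min_eq_left (hz (φ j) i (hj.trans_le hφ.le_apply))
  obtain ⟨j, hj⟩ := (hlim'.eventually (hV.mem_nhds (hm hw))).exists
  exact hzV _ hj

variable {Z : Type*} [MeasurableSpace Z]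

/-- Sets of branches bounded on finitely many coordinates approximate the image from below. -/
theorem exists_bounds_lt_measure_image (f : (ℕ → ℕ) → Z) (μ : Measure Z) {c : ℝ≥0∞}
    (hc : c < μ (range f)) :
    ∃ m : ℕ → ℕ, ∀ N, c < μ (f '' {z | ∀ i < N, z i ≤ m i}) := by
  have step : ∀ (N : ℕ) (S : Set (ℕ → ℕ)), c < μ (f '' S) →
      ∃ a, c < μ (f '' {z ∈ S | z N ≤ a}) := by
    intro N S hS
    have hmono : Monotone fun a => f '' {z ∈ S | z N ≤ a} := fun a b hab =>
      image_mono fun z hz => ⟨hz.1, hz.2.trans hab⟩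
    have hunion : f '' S = ⋃ a, f '' {z ∈ S | z N ≤ a} := by
      rw [← image_iUnion]
      congr 1
      ext z
      simp only [mem_iUnion, mem_ofPred_eq]
      exact ⟨fun h => ⟨z N, h, le_rfl⟩, fun ⟨_, h, _⟩ => h⟩
    rw [hunion, hmono.measure_iUnion] at hS
    exact lt_iSup_iff.1 hS
  choose! next hnext using step
  let S : ℕ → Set (ℕ → ℕ) := fun N =>
    Nat.rec univ (fun N S => {z ∈ S | z N ≤ next N S}) N
  have hS : ∀ N, c < μ (f '' S N) := by
    intro N
    induction N with
    | zero => simpa [S] using hc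
    | succ N ih => exact hnext N _ ih
  have hSeq : ∀ N, S N = {z | ∀ i < N, z i ≤ next i (S i)} := by
    intro N
    induction N with
    | zero => simp [S]
    | succ N ih =>
      have hstep : S (N + 1) = {z ∈ S N | z N ≤ next N (S N)} := rfl
      rw [hstep]
      ext z
      rw [mem_ofPred_eq, ih, mem_ofPred_eq, mem_ofPred_eq, ← ih, Nat.forall_lt_succ_right]
  exact ⟨fun i => next i (S i), fun N => hSeq N ▸ hS N⟩

variable [TopologicalSpace Z]

theorem exists_isCompact_subset_range_le_measure {f : (ℕ → ℕ) → Z} (hf : Continuous f)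
    (μ : Measure Z) [μ.OuterRegular] {c : ℝ≥0∞} (hc : c < μ (range f)) :
    ∃ K ⊆ range f, IsCompact K ∧ c ≤ μ K := by
  obtain ⟨m, hm⟩ := exists_bounds_lt_measure_image f μ hc
  refine ⟨f '' {z | ∀ i, z i ≤ m i}, image_subset_range _ _, (isCompact_setOf_forall_le m).image hf, ?_⟩
  rw [Set.measure_eq_iInf_isOpen]
  refine le_iInf fun U => le_iInf fun hKU => le_iInf fun hU => ?_
  obtain ⟨N, hN⟩ := exists_forall_lt_le_subset_of_isOpen (hU.preimage hf) m
    (image_subset_iff.1 hKU)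
  exact (hm N).le.trans (measure_mono (image_subset_iff.2 hN))

variable [T2Space Z] [BorelSpace Z]

theorem _root_.MeasureTheory.AnalyticSet.nullMeasurableSet {s : Set Z} (hs : AnalyticSet s)
    (μ : Measure Z) [IsFiniteMeasure μ] [μ.OuterRegular] : NullMeasurableSet s μ := by
  rw [AnalyticSet] at hs
  rcases hs with rfl | ⟨f, hf, rfl⟩
  · exact MeasurableSet.empty.nullMeasurableSet
  rcases eq_or_ne (μ (range f)) 0 with h0 | h0
  · exact NullMeasurableSet.of_null h0
  obtain ⟨c, -, hc, hlim⟩ := exists_seq_strictMono_tendsto' (pos_iff_ne_zero.2 h0)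
  choose K hKs hK hcK using fun n => exists_isCompact_subset_range_le_measure hf μ (hc n).2
  have hsub : (⋃ n, K n) ⊆ range f := iUnion_subset hKs
  have hmeas : MeasurableSet (⋃ n, K n) := MeasurableSet.iUnion fun n => (hK n).measurableSet
  have hle : μ (range f) ≤ μ (⋃ n, K n) := le_of_tendsto' hlim fun n =>
    (hcK n).trans (measure_mono (subset_iUnion K n))
  have h1 : (⋃ n, K n : Set Z) =ᵐ[μ] toMeasurable μ (range f) :=
    ae_eq_of_subset_of_measure_ge (hsub.trans (subset_toMeasurable _ _))
      (by rwa [measure_toMeasurable]) hmeas.nullMeasurableSet (measure_ne_top _ _)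
  refine hmeas.nullMeasurableSet.congr ?_
  filter_upwards [h1] with z hz
  refine propext ⟨fun h => hsub h, fun h => ?_⟩
  exact hz.symm.mp (subset_toMeasurable μ (range f) h)

end Capacity

/-! ### Measurable projection and selection over a complete probability space -/

section Selection

open Topology

variable {Y : Type*} [MeasurableSpace Y]

theorem comap_mapNatBool (α : Type*) [m : MeasurableSpace α]
    [MeasurableSpace.CountablyGenerated α] :
    MeasurableSpace.comap (MeasurableSpace.mapNatBool α) inferInstance = m := by
  refine le_antisymm (MeasurableSpace.measurable_mapNatBool α).comap_le ?_
  conv_lhs => rw [← MeasurableSpace.generateFrom_natGeneratingSequence α]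
  refine MeasurableSpace.generateFrom_le ?_
  rintro _ ⟨n, rfl⟩
  refine ⟨{z | z n = true}, measurableSet_eq_fun (measurable_pi_apply n) measurable_const, ?_⟩
  ext a
  simp [MeasurableSpace.mapNatBool]

/-- Over a countably generated space, measurable subsets of `α × Y` are pulled back from
`(ℕ → Bool) × Y`. -/
theorem exists_measurableSet_preimage_prodMap {α : Type*} [MeasurableSpace α]
    [MeasurableSpace.CountablyGenerated α] {A : Set (α × Y)} (hA : MeasurableSet A) :
    ∃ B : Set ((ℕ → Bool) × Y), MeasurableSet B ∧
      Prod.map (MeasurableSpace.mapNatBool α) id ⁻¹' B = A := by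
  have h : (Prod.instMeasurableSpace : MeasurableSpace (α × Y)) =
      MeasurableSpace.comap (Prod.map (MeasurableSpace.mapNatBool α) id) inferInstance := by
    change MeasurableSpace.comap Prod.fst _ ⊔ MeasurableSpace.comap Prod.snd _ =
      MeasurableSpace.comap _ (MeasurableSpace.comap Prod.fst _ ⊔ MeasurableSpace.comap Prod.snd _)
    rw [MeasurableSpace.comap_sup, MeasurableSpace.comap_comp, MeasurableSpace.comap_comp]
    congr 1
    conv_lhs => rw [← comap_mapNatBool α]
    rw [MeasurableSpace.comap_comp]
    rfl
  rw [h] at hA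
  exact hA

theorem measurableSet_preimage_of_analyticSet {α : Type*} [MeasurableSpace α] (P : Measure α)
    [IsFiniteMeasure P] [P.IsComplete] {φ : α → ℕ → Bool} (hφ : Measurable φ)
    {s : Set (ℕ → Bool)} (hs : AnalyticSet s) : MeasurableSet (φ ⁻¹' s) :=
  ((hs.nullMeasurableSet (P.map φ)).preimage
    ⟨hφ, Measure.AbsolutelyContinuous.rfl⟩).measurable_of_complete

instance polishSpace_nat_to_bool : PolishSpace (ℕ → Bool) := {}

variable [TopologicalSpace Y] [PolishSpace Y] [BorelSpace Y]

/-- **Measurable projection theorem**. -/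
theorem measurableSet_image_fst {α : Type*} [MeasurableSpace α]
    [MeasurableSpace.CountablyGenerated α] (P : Measure α) [IsFiniteMeasure P] [P.IsComplete]
    {A : Set (α × Y)} (hA : MeasurableSet A) : MeasurableSet (Prod.fst '' A) := by
  obtain ⟨B, hB, rfl⟩ := exists_measurableSet_preimage_prodMap hA
  have h : Prod.fst '' (Prod.map (MeasurableSpace.mapNatBool α) (id : Y → Y) ⁻¹' B) =
      MeasurableSpace.mapNatBool α ⁻¹' (Prod.fst '' B) := by
    ext a
    simp
  rw [h]
  exact measurableSet_preimage_of_analyticSet P (MeasurableSpace.measurable_mapNatBool α)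
    (hB.analyticSet.image_of_continuous continuous_fst)

theorem measurableSet_sInf_eq {α : Type*} [MeasurableSpace α] {D : ℕ → Set α}
    (hD : ∀ a, MeasurableSet (D a)) (a : ℕ) : MeasurableSet {ω | sInf {b | ω ∈ D b} = a} := by
  have h : {ω | sInf {b | ω ∈ D b} = a} =
      (D a ∩ ⋂ b ∈ Iio a, (D b)ᶜ) ∪ ({_ω | a = 0} ∩ ⋂ b, (D b)ᶜ) := by
    ext ω
    simp only [mem_ofPred_eq, mem_union, mem_inter_iff, mem_iInter, mem_compl_iff, mem_Iio]
    constructor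
    · rintro rfl
      rcases {b | ω ∈ D b}.eq_empty_or_nonempty with h | h
      · exact Or.inr ⟨by rw [h, Nat.sInf_empty], fun b hb => (h.subset hb : b ∈ (∅ : Set ℕ))⟩
      · exact Or.inl ⟨Nat.sInf_mem h, fun b hb => Nat.notMem_of_lt_sInf hb⟩
    · rintro (⟨h, h'⟩ | ⟨rfl, h⟩)
      · refine le_antisymm (Nat.sInf_le h) (le_csInf ⟨a, h⟩ fun b hb => ?_)
        by_contra! hlt
        exact h' b hlt hb
      · rw [Nat.sInf_eq_zero]
        exact Or.inr (eq_empty_of_forall_notMem h)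
  rw [h]
  refine ((hD a).inter ?_).union ((MeasurableSet.const _).inter ?_)
  · exact MeasurableSet.biInter (to_countable _) fun b _ => (hD b).compl
  · exact MeasurableSet.iInter fun b => (hD b).compl

/-- The branch obtained by following, from the root of the tree of nonempty pieces at `ω`, the
least available child at each stage. -/
noncomputable def leastBranch {α : Type*} (D : List ℕ → Set α) (ω : α) : ℕ → List ℕ
  | 0 => []
  | n + 1 => sInf {a | ω ∈ D (a :: leastBranch D ω n)} :: leastBranch D ω n

/-- A measurable tree of sets without dead ends admits a measurable branch. -/
theorem exists_measurable_branch {α : Type*} [MeasurableSpace α] {D : List ℕ → Set α}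
    (hD : ∀ l, MeasurableSet (D l)) (hsub : ∀ l, D l ⊆ ⋃ a, D (a :: l)) :
    ∃ z : α → ℕ → ℕ, Measurable z ∧ ∀ ω ∈ D [], ∀ n, ω ∈ D (PiNat.res (z ω) n) := by
  have hmeas : ∀ n l, MeasurableSet {ω | leastBranch D ω n = l} := by
    intro n
    induction n with
    | zero => exact fun l => MeasurableSet.const ([] = l)
    | succ n ih =>
      rintro (_ | ⟨a, l⟩)
      · simp [leastBranch]
      · have h : {ω | leastBranch D ω (n + 1) = a :: l} =
            {ω | leastBranch D ω n = l} ∩ {ω | sInf {b | ω ∈ D (b :: l)} = a} := by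
          ext ω
          simp only [leastBranch, List.cons.injEq, mem_inter_iff, mem_ofPred_eq]
          constructor
          · rintro ⟨h, rfl⟩; exact ⟨rfl, h⟩
          · rintro ⟨rfl, h⟩; exact ⟨h, rfl⟩
        rw [h]
        exact (ih l).inter (measurableSet_sInf_eq (fun b => hD (b :: l)) a)
  let z : α → ℕ → ℕ := fun ω n => sInf {a | ω ∈ D (a :: leastBranch D ω n)}
  have hres : ∀ ω n, PiNat.res (z ω) n = leastBranch D ω n := by
    intro ω n
    induction n with
    | zero => rfl
    | succ n ih => rw [PiNat.res_succ, ih]; rfl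
  refine ⟨z, measurable_pi_lambda _ fun n => measurable_to_countable' fun a => ?_, ?_⟩
  · have h : (fun ω => z ω n) ⁻¹' {a} = ⋃ l, {ω | leastBranch D ω (n + 1) = a :: l} := by
      ext ω
      simp [leastBranch, z]
    rw [h]
    exact MeasurableSet.iUnion fun l => hmeas _ _
  · intro ω hω n
    rw [hres]
    induction n with
    | zero => exact hω
    | succ n ih =>
      have h : {a | ω ∈ D (a :: leastBranch D ω n)}.Nonempty := mem_iUnion.1 (hsub _ ih)
      exact Nat.sInf_mem h

theorem isOpen_setOf_res_eq (l : List ℕ) : IsOpen {z : ℕ → ℕ | PiNat.res z l.length = l} := by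
  rw [isOpen_iff_forall_mem_open]
  intro w hw
  refine ⟨PiNat.cylinder w l.length, fun z hz => ?_, PiNat.isOpen_cylinder _ _ _,
    PiNat.self_mem_cylinder _ _⟩
  rw [PiNat.cylinder_eq_res] at hz
  exact Eq.trans hz hw

/-- **Aumann–von Neumann measurable selection theorem**. -/
theorem exists_measurable_selection {α : Type*} [MeasurableSpace α]
    [MeasurableSpace.CountablyGenerated α] (P : Measure α) [IsFiniteMeasure P] [P.IsComplete]
    [Nonempty Y] {A : Set (α × Y)} (hA : MeasurableSet A) :
    ∃ g : α → Y, Measurable g ∧ ∀ ω ∈ Prod.fst '' A, (ω, g ω) ∈ A := by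
  obtain ⟨B, hB, rfl⟩ := exists_measurableSet_preimage_prodMap hA
  have hBa := hB.analyticSet
  rw [AnalyticSet] at hBa
  rcases hBa with rfl | ⟨F, hF, rfl⟩
  · exact ⟨fun _ => Classical.arbitrary Y, measurable_const, by simp⟩
  set φ := MeasurableSpace.mapNatBool α
  let D : List ℕ → Set α := fun l =>
    φ ⁻¹' ((fun z => (F z).1) '' {z | PiNat.res z l.length = l})
  have hD : ∀ l, MeasurableSet (D l) := fun l =>
    measurableSet_preimage_of_analyticSet P (MeasurableSpace.measurable_mapNatBool α)
      ((isOpen_setOf_res_eq l).analyticSet_image (by fun_prop))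
  have hsub : ∀ l, D l ⊆ ⋃ a, D (a :: l) := by
    rintro l ω ⟨z, hz, hzω⟩
    refine mem_iUnion.2 ⟨z l.length, z, ?_, hzω⟩
    rw [mem_ofPred_eq] at hz
    rw [mem_ofPred_eq, List.length_cons, PiNat.res_succ, hz]
  obtain ⟨z, hzm, hz⟩ := exists_measurable_branch hD hsub
  refine ⟨fun ω => (F (z ω)).2, (continuous_snd.comp hF).measurable.comp hzm, ?_⟩
  rintro _ ⟨⟨ω, y⟩, ⟨z₀, hz₀⟩, rfl⟩
  have hω : ω ∈ D [] := ⟨z₀, rfl, congrArg Prod.fst hz₀⟩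
  choose w hw hwω using hz ω hω
  have hlim : Tendsto w atTop (𝓝 (z ω)) := by
    rw [tendsto_pi_nhds]
    intro i
    refine tendsto_const_nhds.congr' ?_
    filter_upwards [eventually_gt_atTop i] with j hj
    have h := hw j
    rw [mem_ofPred_eq, PiNat.res_length] at h
    exact (PiNat.res_eq_res.1 h hj).symm
  have hlimF : Tendsto (fun n => (F (w n)).1) atTop (𝓝 (F (z ω)).1) :=
    ((continuous_fst.comp hF).tendsto _).comp hlim
  have heq : (F (z ω)).1 = φ ω :=
    tendsto_nhds_unique hlimF (tendsto_const_nhds.congr fun n => (hwω n).symm)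
  exact ⟨z ω, Prod.ext heq rfl⟩

end Selection

/-! ### Separated tuples in pre-image fibers -/

section SeparatedTuples

variable {ϑ : Ω → Ω} {T : Ω → X → X} {E : Set (Ω × X)} {f : Ω → X → ℝ} {n k : ℕ} {ε : ℝ} {x : X}

section Measurability

omit [MetricSpace X] [CompactSpace X] [BorelSpace X]

theorem measurable_Tn (hϑ : Measurable ϑ) (hT : Measurable fun p : Ω × X => T p.1 p.2) (i : ℕ) :
    Measurable fun p : Ω × X => Tn ϑ T i p.1 p.2 := by
  induction i with
  | zero => exact measurable_snd
  | succ i ih => exact ih.comp ((hϑ.comp measurable_fst).prodMk hT)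

theorem measurable_Snf (hϑ : Measurable ϑ) (hT : Measurable fun p : Ω × X => T p.1 p.2)
    (hf : Measurable fun p : Ω × X => f p.1 p.2) :
    Measurable fun p : Ω × X => Snf ϑ T f n p.1 p.2 :=
  Finset.measurable_fun_sum _ fun i _ =>
    hf.comp (((hϑ.iterate i).comp measurable_fst).prodMk (measurable_Tn hϑ hT i))

theorem measurable_sum_exp_Snf (hϑ : Measurable ϑ) (hT : Measurable fun p : Ω × X => T p.1 p.2)
    (hf : Measurable fun p : Ω × X => f p.1 p.2) (m : ℕ) :
    Measurable fun p : Ω × (Fin m → X) => ∑ j, Real.exp (Snf ϑ T f n p.1 (p.2 j)) :=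
  Finset.measurable_fun_sum _ fun j _ => Real.measurable_exp.comp
    ((measurable_Snf hϑ hT hf).comp
      (measurable_fst.prodMk ((measurable_pi_apply j).comp measurable_snd)))

end Measurability

section Metric

omit [MeasurableSpace Ω] [CompactSpace X] [MeasurableSpace X] [BorelSpace X]

theorem lt_dn_iff (hε : 0 ≤ ε) {ω : Ω} {y z : X} :
    ε < dn ϑ T n ω y z ↔ ∃ i < n, ε < dist (Tn ϑ T i ω y) (Tn ϑ T i ω z) := by
  lift ε to NNReal using hε
  simp only [dn, NNReal.coe_lt_coe, Finset.lt_sup_iff, Finset.mem_range, ← coe_nndist]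

theorem dn_self (ω : Ω) (y : X) : dn ϑ T n ω y y = 0 := by
  simp [dn]

/-- A uniform bound on the cardinality of separated sets; continuity of `T` plays no role, because
`d_n^ω` is the pull-back of the sup metric on the compact space `X^n`. -/
theorem exists_card_le_of_isSep [CompactSpace X] (ϑ : Ω → Ω) (T : Ω → X → X) (n : ℕ)
    (hε : 0 < ε) : ∃ N : ℕ, ∀ (ω : Ω) (F : Finset X), IsSep ϑ T n ε ω ↑F → F.card ≤ N := by
  obtain ⟨t, -, ht, hcover⟩ := finite_cover_balls_of_compact (isCompact_univ (X := X))
    (half_pos hε)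
  have hc : ∀ y : X, ∃ c : t, dist y c < ε / 2 := by
    intro y
    obtain ⟨c, hc, hy⟩ := mem_iUnion₂.1 (hcover (mem_univ y))
    exact ⟨⟨c, hc⟩, hy⟩
  choose c hc using hc
  have := ht.fintype
  classical
  refine ⟨Fintype.card (Fin n → t), fun ω F hF => ?_⟩
  rw [← Fintype.card_coe F]
  refine Fintype.card_le_of_injective (fun (y : F) (i : Fin n) => c (Tn ϑ T i ω y)) ?_
  intro y z hyz
  by_contra hne
  obtain ⟨i, hi, hlt⟩ := (lt_dn_iff hε.le).1 (hF y y.2 z z.2 fun h => hne (Subtype.ext h))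
  have heq : c (Tn ϑ T i ω y) = c (Tn ϑ T i ω z) := congrFun hyz ⟨i, hi⟩
  have h1 := hc (Tn ϑ T i ω y)
  have h2 := hc (Tn ϑ T i ω z)
  rw [heq] at h1
  linarith [dist_triangle_right (Tn ϑ T i ω y) (Tn ϑ T i ω z) (c (Tn ϑ T i ω z))]

/-- The pairs `(ω, y)` with `y` an `m`-tuple of pairwise `(ω,n,ε)`-separated points of
`(T_ω^k)^{-1} x`. -/
def sepTuples (ϑ : Ω → Ω) (T : Ω → X → X) (E : Set (Ω × X)) (n k : ℕ) (ε : ℝ) (x : X) (m : ℕ) :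
    Set (Ω × (Fin m → X)) :=
  {p | (∀ j, p.2 j ∈ preFiber ϑ T E k x p.1) ∧
    ∀ i j, i ≠ j → ε < dn ϑ T n p.1 (p.2 i) (p.2 j)}

theorem injective_of_mem_sepTuples (hε : 0 < ε) {m : ℕ} {ω : Ω} {y : Fin m → X}
    (hy : (ω, y) ∈ sepTuples ϑ T E n k ε x m) : Function.Injective y := by
  intro i j hij
  by_contra hne
  have h : ε < dn ϑ T n ω (y i) (y j) := hy.2 i j hne
  rw [hij, dn_self] at h
  exact h.not_gt hε

theorem isSep_image_of_mem_sepTuples [DecidableEq X] {m : ℕ} {ω : Ω} {y : Fin m → X}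
    (hy : (ω, y) ∈ sepTuples ϑ T E n k ε x m) :
    IsSep ϑ T n ε ω ↑(Finset.univ.image y) := by
  intro a ha b hb hab
  obtain ⟨i, -, rfl⟩ := Finset.mem_image.1 (Finset.mem_coe.1 ha)
  obtain ⟨j, -, rfl⟩ := Finset.mem_image.1 (Finset.mem_coe.1 hb)
  exact hy.2 i j fun h => hab (congrArg y h)

theorem exists_mem_sepTuples {ω : Ω} {F : Finset X} (hF : ↑F ⊆ preFiber ϑ T E k x ω)
    (hsep : IsSep ϑ T n ε ω ↑F) :
    ∃ y : Fin F.card → X, (ω, y) ∈ sepTuples ϑ T E n k ε x F.card ∧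
      ∀ φ : X → ℝ, ∑ j, φ (y j) = ∑ a ∈ F, φ a := by
  refine ⟨fun j => F.equivFin.symm j, ⟨fun j => hF (F.equivFin.symm j).2, fun i j hij =>
    hsep _ (F.equivFin.symm i).2 _ (F.equivFin.symm j).2 fun h =>
      hij (F.equivFin.symm.injective (Subtype.ext h))⟩, fun φ => ?_⟩
  rw [← Finset.sum_coe_sort F φ]
  exact F.equivFin.symm.sum_comp fun a : F => φ a

theorem bddAbove_sums (hE : ∀ ω, IsCompact (fiber E ω))
    (hT : ∀ ω, MapsTo (T ω) (fiber E ω) (fiber E (ϑ ω)))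
    (hf : ∀ ω, ContinuousOn (f ω) (fiber E ω)) {N : ℕ}
    (hN : ∀ (ω : Ω) (F : Finset X), IsSep ϑ T n ε ω ↑F → F.card ≤ N) (ω : Ω) :
    BddAbove {r : ℝ | ∃ F : Finset X, ↑F ⊆ preFiber ϑ T E k x ω ∧ IsSep ϑ T n ε ω ↑F ∧
      r = ∑ y ∈ F, Real.exp (Snf ϑ T f n ω y)} := by
  have hTn : ∀ i ω, MapsTo (Tn ϑ T i ω) (fiber E ω) (fiber E (ϑ^[i] ω)) := by
    intro i
    induction i with
    | zero => exact fun ω y hy => hy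
    | succ i ih => exact fun ω y hy => ih (ϑ ω) (hT ω hy)
  choose C hC using fun i => (hE (ϑ^[i] ω)).bddAbove_image (hf (ϑ^[i] ω))
  refine ⟨N * Real.exp (∑ i ∈ Finset.range n, C i), ?_⟩
  rintro _ ⟨F, hF, hsep, rfl⟩
  calc ∑ y ∈ F, Real.exp (Snf ϑ T f n ω y)
      ≤ F.card • Real.exp (∑ i ∈ Finset.range n, C i) :=
        Finset.sum_le_card_nsmul _ _ _ fun y hy => Real.exp_le_exp.2 <|
          Finset.sum_le_sum fun i _ => hC i (mem_image_of_mem _ (hTn i ω (hF hy).1))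
    _ ≤ N * Real.exp (∑ i ∈ Finset.range n, C i) := by
        rw [nsmul_eq_mul]
        gcongr
        exact hN ω F hsep

theorem nonempty_sums (ω : Ω) :
    {r : ℝ | ∃ F : Finset X, ↑F ⊆ preFiber ϑ T E k x ω ∧ IsSep ϑ T n ε ω ↑F ∧
      r = ∑ y ∈ F, Real.exp (Snf ϑ T f n ω y)}.Nonempty :=
  ⟨0, ∅, by simp, by simp [IsSep], by simp⟩

theorem exists_lt_sum_of_lt_PpreN {ω : Ω} {a : ℝ} (ha : a < PpreN ϑ T E f n k ε x ω) :
    ∃ F : Finset X, ↑F ⊆ preFiber ϑ T E k x ω ∧ IsSep ϑ T n ε ω ↑F ∧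
      a < ∑ y ∈ F, Real.exp (Snf ϑ T f n ω y) := by
  obtain ⟨_, ⟨F, hF, hsep, rfl⟩, hlt⟩ := exists_lt_of_lt_csSup (nonempty_sums ω) ha
  exact ⟨F, hF, hsep, hlt⟩

theorem PpreN_pos {ω : Ω}
    (hbdd : BddAbove {r : ℝ | ∃ F : Finset X, ↑F ⊆ preFiber ϑ T E k x ω ∧
      IsSep ϑ T n ε ω ↑F ∧ r = ∑ y ∈ F, Real.exp (Snf ϑ T f n ω y)})
    (hne : (preFiber ϑ T E k x ω).Nonempty) : 0 < PpreN ϑ T E f n k ε x ω := by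
  obtain ⟨y, hy⟩ := hne
  exact (Real.exp_pos (Snf ϑ T f n ω y)).trans_le
    (le_csSup hbdd ⟨{y}, by simpa using hy, by simp [IsSep], by simp⟩)

end Metric

theorem measurableSet_sepTuples (hϑ : Measurable ϑ)
    (hT : Measurable fun p : Ω × X => T p.1 p.2) (hE : MeasurableSet E) (hε : 0 ≤ ε) (m : ℕ) :
    MeasurableSet (sepTuples ϑ T E n k ε x m) := by
  have hproj : ∀ j : Fin m, Measurable fun p : Ω × (Fin m → X) => (p.1, p.2 j) := fun j =>
    measurable_fst.prodMk ((measurable_pi_apply j).comp measurable_snd)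
  have hpre : MeasurableSet {p : Ω × X | p.2 ∈ preFiber ϑ T E k x p.1} :=
    hE.inter ((measurable_Tn hϑ hT k) (measurableSet_singleton x))
  have h : sepTuples ϑ T E n k ε x m =
      (⋂ j, (fun p : Ω × (Fin m → X) => (p.1, p.2 j)) ⁻¹'
        {p : Ω × X | p.2 ∈ preFiber ϑ T E k x p.1}) ∩
      ⋂ i, ⋂ j, ⋂ _ : i ≠ j, ⋃ l, ⋃ _ : l < n,
        {p | ε < dist (Tn ϑ T l p.1 (p.2 i)) (Tn ϑ T l p.1 (p.2 j))} := by
    ext p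
    simp [sepTuples, lt_dn_iff hε]
  rw [h]
  refine MeasurableSet.inter (MeasurableSet.iInter fun j => hproj j hpre)
    (MeasurableSet.iInter fun i => MeasurableSet.iInter fun j => MeasurableSet.iInter fun _ =>
      MeasurableSet.iUnion fun l => MeasurableSet.iUnion fun _ => ?_)
  exact measurableSet_lt measurable_const
    (((measurable_Tn hϑ hT l).comp (hproj i)).dist ((measurable_Tn hϑ hT l).comp (hproj j)))

theorem measurable_PpreN [MeasurableSpace.CountablyGenerated Ω] (P : Measure Ω)
    [IsFiniteMeasure P] [P.IsComplete] (hϑ : Measurable ϑ)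
    (hT : Measurable fun p : Ω × X => T p.1 p.2) (hE : MeasurableSet E)
    (hf : Measurable fun p : Ω × X => f p.1 p.2) (hε : 0 < ε)
    (hbdd : ∀ ω, BddAbove {r : ℝ | ∃ F : Finset X, ↑F ⊆ preFiber ϑ T E k x ω ∧
      IsSep ϑ T n ε ω ↑F ∧ r = ∑ y ∈ F, Real.exp (Snf ϑ T f n ω y)}) :
    Measurable fun ω => PpreN ϑ T E f n k ε x ω := by
  refine measurable_of_Ioi fun a => ?_
  have h : (fun ω => PpreN ϑ T E f n k ε x ω) ⁻¹' Ioi a =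
      ⋃ m : ℕ, Prod.fst '' {p ∈ sepTuples ϑ T E n k ε x m |
        a < ∑ j, Real.exp (Snf ϑ T f n p.1 (p.2 j))} := by
    classical
    ext ω
    rw [mem_iUnion]
    constructor
    · intro hω
      obtain ⟨F, hF, hsep, hlt⟩ := exists_lt_sum_of_lt_PpreN hω
      obtain ⟨y, hy, hsum⟩ := exists_mem_sepTuples hF hsep
      refine ⟨F.card, (ω, y), ⟨hy, ?_⟩, rfl⟩
      rwa [← hsum fun a => Real.exp (Snf ϑ T f n ω a)] at hlt
    · rintro ⟨m, ⟨_, y⟩, ⟨hy, hlt⟩, rfl⟩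
      refine lt_csSup_of_lt (hbdd _) ⟨Finset.univ.image y, ?_, isSep_image_of_mem_sepTuples hy,
        rfl⟩ ?_
      · intro a ha
        obtain ⟨i, -, rfl⟩ := Finset.mem_image.1 (Finset.mem_coe.1 ha)
        exact hy.1 i
      · rwa [Finset.sum_image fun i _ j _ h => injective_of_mem_sepTuples hε hy h]
  rw [h]
  exact MeasurableSet.iUnion fun m => measurableSet_image_fst P
    ((measurableSet_sepTuples hϑ hT hE hε.le m).inter
      (measurableSet_lt measurable_const (measurable_sum_exp_Snf hϑ hT hf m)))

end SeparatedTuples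

/-- **Lemma 3.1**: measurability of `ω ↦ P_{pre,n,ω}(T,f,ε,(T_ω^k)^{-1}x)`, and existence
    of measurable families of maximal `(ω,n,ε)`-separated sets almost realizing it. -/
theorem measurable_PpreN_and_exists_measurable_maximal_separated
    {Ω : Type} [MeasurableSpace Ω] {X : Type} [MetricSpace X] [CompactSpace X]
    [MeasurableSpace X] [BorelSpace X]
    (P : Measure Ω) [IsProbabilityMeasure P]
    -- `F` is complete, countably generated and separates points
    (hcomplete : ∀ s t : Set Ω, MeasurableSet t → P t = 0 → s ⊆ t → MeasurableSet s)
    [MeasurableSpace.CountablyGenerated Ω]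
    (hsepPts : ∀ ω₁ ω₂ : Ω, ω₁ ≠ ω₂ → ∃ s : Set Ω, MeasurableSet s ∧ ω₁ ∈ s ∧ ω₂ ∉ s)
    -- `ϑ` is an invertible `P`-preserving transformation
    (ϑ : Ω → Ω) (hϑ : MeasurePreserving ϑ P P) (hϑbij : Function.Bijective ϑ)
    -- `E` is measurable with compact fibers
    (E : Set (Ω × X)) (hE : MeasurableSet E) (hEcomp : ∀ ω, IsCompact (fiber E ω))
    -- `T` is a continuous bundle RDS on `E`
    (T : Ω → X → X) (hTmap : ∀ ω, MapsTo (T ω) (fiber E ω) (fiber E (ϑ ω)))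
    (hTmeas : Measurable fun p : Ω × X => T p.1 p.2)
    (hTcont : ∀ᵐ ω ∂P, ContinuousOn (T ω) (fiber E ω))
    -- nonempty pre-image fibers
    (hfib : ∀ k : ℕ, ∀ x ∈ XE E, ∀ ω : Ω, (preFiber ϑ T E k x ω).Nonempty)
    -- `f ∈ L¹_E(Ω, C(X))`
    (f : Ω → X → ℝ) (hfmeas : Measurable fun p : Ω × X => f p.1 p.2)
    (hfcont : ∀ ω, ContinuousOn (f ω) (fiber E ω))
    (hfint : Integrable (fun ω => sSup ((fun x => |f ω x|) '' fiber E ω)) P)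
    (x : X) (hx : x ∈ XE E) (k n : ℕ) (hk : n ≤ k) (ε : ℝ) (hε : 0 < ε) :
    Measurable (fun ω => PpreN ϑ T E f n k ε x ω) ∧
    ∀ δ > (0 : ℝ), ∃ G : Ω → Finset X,
      (∀ ω : Ω,
        -- `G_ω` is a maximal `(ω,n,ε)`-separated subset of `(T_ω^k)^{-1}x`
        ↑(G ω) ⊆ preFiber ϑ T E k x ω ∧
        IsSep ϑ T n ε ω ↑(G ω) ∧
        (∀ y ∈ preFiber ϑ T E k x ω, y ∉ (G ω : Set X) →
          ¬ IsSep ϑ T n ε ω (insert y ↑(G ω))) ∧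
        -- `G_ω` almost realizes the supremum
        (1 - δ) * PpreN ϑ T E f n k ε x ω ≤ ∑ y ∈ G ω, Real.exp (Snf ϑ T f n ω y)) ∧
      -- the family depends measurably on `ω`: `{(ω,y) : y ∈ G_ω} ∈ F × B`
      MeasurableSet {p : Ω × X | p.2 ∈ G p.1} := by
  have : P.IsComplete := ⟨fun s hs => by
    obtain ⟨t, hst, ht, h0⟩ := exists_measurable_superset_of_null hs
    exact hcomplete s t ht h0 hst⟩
  have hθ := hϑ.measurable
  obtain ⟨N, hN⟩ := exists_card_le_of_isSep ϑ T n hε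
  have hbdd := fun ω => bddAbove_sums (k := k) (x := x) hEcomp hTmap hfcont hN ω
  have hmeasP : Measurable fun ω => PpreN ϑ T E f n k ε x ω :=
    measurable_PpreN P hθ hTmeas hE hfmeas hε hbdd
  refine ⟨hmeasP, fun δ hδ => ?_⟩
  have : Nonempty X := ⟨x⟩
  let B : ∀ m : ℕ, Set (Ω × (Fin m → X)) := fun m =>
    {p ∈ sepTuples ϑ T E n k ε x m | (1 - δ) * PpreN ϑ T E f n k ε x p.1 <
      ∑ j, Real.exp (Snf ϑ T f n p.1 (p.2 j))}
  have hB : ∀ m, MeasurableSet (B m) := fun m =>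
    (measurableSet_sepTuples hθ hTmeas hE hε.le m).inter (measurableSet_lt
      ((hmeasP.comp measurable_fst).const_mul _) (measurable_sum_exp_Snf hθ hTmeas hfmeas m))
  have hBF : ∀ (ω : Ω) (F : Finset X), ↑F ⊆ preFiber ϑ T E k x ω → IsSep ϑ T n ε ω ↑F →
      (1 - δ) * PpreN ϑ T E f n k ε x ω < ∑ y ∈ F, Real.exp (Snf ϑ T f n ω y) →
      ω ∈ Prod.fst '' B F.card := by
    intro ω F hF hsep hlt
    obtain ⟨y, hy, hsum⟩ := exists_mem_sepTuples hF hsep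
    rw [← hsum fun a => Real.exp (Snf ϑ T f n ω a)] at hlt
    exact ⟨(ω, y), ⟨hy, hlt⟩, rfl⟩
  have hBN : ∀ m, ∀ ω ∈ Prod.fst '' B m, m ≤ N := by
    classical
    rintro m _ ⟨⟨ω, y⟩, ⟨hy, -⟩, rfl⟩
    have h := hN ω _ (isSep_image_of_mem_sepTuples hy)
    rwa [Finset.card_image_of_injective _ (injective_of_mem_sepTuples hε hy), Finset.card_univ,
      Fintype.card_fin] at h
  choose g hg hgB using fun m => exists_measurable_selection P (hB m)
  classical
  let M : Ω → ℕ := fun ω => Nat.findGreatest (fun m => ω ∈ Prod.fst '' B m) N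
  have hM : Measurable M := measurable_findGreatest fun m _ => measurableSet_image_fst P (hB m)
  have hMB : ∀ ω, ω ∈ Prod.fst '' B (M ω) := by
    intro ω
    obtain ⟨F, hF, hsep, hlt⟩ := exists_lt_sum_of_lt_PpreN
      (show (1 - δ) * PpreN ϑ T E f n k ε x ω < PpreN ϑ T E f n k ε x ω by
        nlinarith [PpreN_pos (hbdd ω) (hfib k x hx ω)])
    have h := hBF ω F hF hsep hlt
    exact Nat.findGreatest_spec (P := fun m => ω ∈ Prod.fst '' B m) (hBN _ ω h) h
  have hmem : ∀ ω, (ω, g (M ω) ω) ∈ B (M ω) := fun ω => hgB _ ω (hMB ω)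
  have hinj : ∀ ω, Function.Injective (g (M ω) ω) := fun ω =>
    injective_of_mem_sepTuples hε (hmem ω).1
  let G : Ω → Finset X := fun ω => Finset.univ.image (g (M ω) ω)
  have hGsub : ∀ ω, ↑(G ω) ⊆ preFiber ϑ T E k x ω := by
    intro ω y hy
    obtain ⟨j, -, rfl⟩ := Finset.mem_image.1 (Finset.mem_coe.1 hy)
    exact (hmem ω).1.1 j
  have hGsep : ∀ ω, IsSep ϑ T n ε ω ↑(G ω) := fun ω =>
    isSep_image_of_mem_sepTuples (hmem ω).1
  have hGlt : ∀ ω, (1 - δ) * PpreN ϑ T E f n k ε x ω <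
      ∑ y ∈ G ω, Real.exp (Snf ϑ T f n ω y) := by
    intro ω
    rw [Finset.sum_image fun i _ j _ h => hinj ω h]
    exact (hmem ω).2
  refine ⟨G, fun ω => ⟨hGsub ω, hGsep ω, fun y hy hyG hsep => ?_, (hGlt ω).le⟩, ?_⟩
  · have hyG' : y ∉ G ω := hyG
    have hcard : (insert y (G ω)).card = M ω + 1 := by
      rw [Finset.card_insert_of_notMem hyG', Finset.card_image_of_injective _ (hinj ω),
        Finset.card_univ, Fintype.card_fin]
    have h : ω ∈ Prod.fst '' B (M ω + 1) := by
      rw [← hcard]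
      refine hBF ω _ ?_ ?_ ((hGlt ω).trans ?_)
      · rw [Finset.coe_insert]
        exact insert_subset hy (hGsub ω)
      · rwa [Finset.coe_insert]
      · rw [Finset.sum_insert hyG']
        exact lt_add_of_pos_left _ (Real.exp_pos _)
    exact Nat.findGreatest_is_greatest (P := fun m => ω ∈ Prod.fst '' B m) (Nat.lt_succ_self _)
      (hBN _ ω h) h
  · have h : {p : Ω × X | p.2 ∈ G p.1} =
        ⋃ m, {p | M p.1 = m} ∩ ⋃ j : Fin m, {p | g m p.1 j = p.2} := by
      ext p
      simp [G]
    rw [h]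
    refine MeasurableSet.iUnion fun m => MeasurableSet.inter
      ((hM.comp measurable_fst) (measurableSet_singleton m)) (MeasurableSet.iUnion fun j => ?_)
    exact measurableSet_eq_fun
      ((measurable_pi_apply j).comp ((hg m).comp measurable_fst)) measurable_snd

end PreImageRDS
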